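/- arXiv:2202.00404 — 2 statements merged into one kernel-verified Lean document; each statement's English description precedes it below -/
import Mathlib

section
/- For every λ>0, b∈(0,1) and integer n ≥ 1, writing ρ(θ) := √(1 − 2b·cos θ + b²), one has −(λb/2π)·∫_0^{2π} K_1(λ·ρ(θ))·(sin θ / ρ(θ))·( sin(nθ) − b·sin((n+1)θ) ) dθ = b·(n+1)·I_{n+1}(λb)·K_{n+1}(λ) − n·I_n(λb)·K_n(λ). -/
open Real MeasureTheory Filter

/-- Modified Bessel function of the first kind `I_n`. -/
noncomputable def besselI (n : ℕ) (x : ℝ) : ℝ :=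
  ∑' m : ℕ, (x / 2) ^ (n + 2 * m) / ((Nat.factorial m : ℝ) * (Nat.factorial (n + m) : ℝ))

/-- Modified Bessel function of the second kind `K_n`. -/
noncomputable def besselK (n : ℕ) (x : ℝ) : ℝ :=
  ∫ t in Set.Ioi (0 : ℝ), Real.exp (-x * Real.cosh t) * Real.cosh ((n : ℝ) * t)

/-- `Λ_n(λ,b) = I_n(λb) K_n(λ)`. -/
noncomputable def Lam (n : ℕ) (l b : ℝ) : ℝ := besselI n (l * b) * besselK n l

/-- `Ω_n(x) = I_1(x)K_1(x) − I_n(x)K_n(x)`. -/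
noncomputable def Om (n : ℕ) (x : ℝ) : ℝ :=
  besselI 1 x * besselK 1 x - besselI n x * besselK n x

/-- Discriminant `Δ_n(λ,b)`. -/
noncomputable def Del (n : ℕ) (l b : ℝ) : ℝ :=
  (b * (Om n l + Om n (l * b)) - (1 + b ^ 2) * Lam 1 l b) ^ 2 - 4 * b ^ 2 * Lam n l b ^ 2

/-- `B_n(λ,b)`. -/
noncomputable def Bfun (n : ℕ) (l b : ℝ) : ℝ :=
  (1 - b ^ 2) * Lam 1 l b + b * (Om n l - Om n (l * b))

/-- `Ω_n^+(λ,b)`. -/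
noncomputable def OmP (n : ℕ) (l b : ℝ) : ℝ :=
  (Bfun n l b + Real.sqrt (Del n l b)) / (2 * b)

/-- `Ω_n^−(λ,b)`. -/
noncomputable def OmM (n : ℕ) (l b : ℝ) : ℝ :=
  (Bfun n l b - Real.sqrt (Del n l b)) / (2 * b)

/-- The matrix `M_n(λ,b,Ω)`. -/
noncomputable def Mmat (n : ℕ) (l b W : ℝ) : Matrix (Fin 2) (Fin 2) ℝ :=
  !![Om n l - W - b * Lam 1 l b, b * Lam n l b;
     -Lam n l b, Lam 1 l b - b * (Om n (l * b) + W)]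

open scoped Topology

theorem one_add_sq_le_cosh_sq (t : ℝ) : 1 + t ^ 2 ≤ Real.cosh t ^ 2 := by
  have h : t ^ 2 ≤ Real.sinh t ^ 2 := by
    rw [sq_le_sq, Real.abs_sinh]
    exact Real.self_le_sinh_iff.2 (abs_nonneg t)
  linarith [Real.cosh_sq t]

theorem exp_neg_cosh_mul_pow_le {c : ℝ} (hc : 0 < c) (N : ℕ) (t : ℝ) :
    Real.exp (-c * Real.cosh t) * Real.cosh t ^ N
      ≤ ((N + 2).factorial / c ^ (N + 2)) * (1 + t ^ 2)⁻¹ := by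
  have hpos : 0 < Real.cosh t := Real.cosh_pos t
  have h1 := Real.pow_div_factorial_le_exp (x := c * Real.cosh t) (by positivity) (N + 2)
  have h2 : Real.exp (-c * Real.cosh t) ≤ ((c * Real.cosh t) ^ (N + 2) / (N + 2).factorial)⁻¹ := by
    rw [neg_mul, Real.exp_neg]
    exact inv_anti₀ (by positivity) h1
  calc Real.exp (-c * Real.cosh t) * Real.cosh t ^ N
      ≤ ((c * Real.cosh t) ^ (N + 2) / (N + 2).factorial)⁻¹ * Real.cosh t ^ N := by gcongr
    _ = ((N + 2).factorial / c ^ (N + 2)) * (Real.cosh t ^ 2)⁻¹ := by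
        rw [mul_pow, inv_div, pow_add (Real.cosh t) N 2]
        field_simp
    _ ≤ _ := by
        gcongr
        exact one_add_sq_le_cosh_sq t

theorem integrable_exp_neg_cosh_mul_pow {c : ℝ} (hc : 0 < c) (N : ℕ) :
    Integrable fun t : ℝ => Real.exp (-c * Real.cosh t) * Real.cosh t ^ N := by
  refine (integrable_inv_one_add_sq.const_mul ((N + 2).factorial / c ^ (N + 2) : ℝ)).mono'
    (by fun_prop) (.of_forall fun t => ?_)
  have hpos : 0 < Real.cosh t := Real.cosh_pos t
  rw [Real.norm_of_nonneg (by positivity)]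
  exact exp_neg_cosh_mul_pow_le hc N t

theorem tendsto_exp_neg_cosh_mul_pow {c : ℝ} (hc : 0 < c) (N : ℕ) :
    Tendsto (fun t : ℝ => Real.exp (-c * Real.cosh t) * Real.cosh t ^ N) (cocompact ℝ) (𝓝 0) := by
  have h : Tendsto (fun t : ℝ => (1 + t ^ 2)⁻¹) (cocompact ℝ) (𝓝 0) := by
    refine tendsto_inv_atTop_zero.comp (tendsto_atTop_mono (f := fun t : ℝ => ‖t‖)
      (fun t => ?_) (tendsto_norm_cocompact_atTop))
    rw [Real.norm_eq_abs, ← sq_abs]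
    nlinarith [sq_nonneg (|t| - 1)]
  refine squeeze_zero (fun t => ?_) (exp_neg_cosh_mul_pow_le hc N)
    (by simpa using h.const_mul ((N + 2).factorial / c ^ (N + 2) : ℝ))
  have hpos : 0 < Real.cosh t := Real.cosh_pos t
  positivity

theorem exp_neg_le_two_mul_cosh (t : ℝ) : Real.exp (-t) ≤ 2 * Real.cosh t := by
  rw [Real.cosh_eq]
  linarith [Real.exp_pos t]

theorem exp_neg_nat_mul_le (m : ℕ) (t : ℝ) :
    Real.exp (-(m * t)) ≤ 2 ^ m * Real.cosh t ^ m := by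
  rw [← mul_pow, ← mul_neg, Real.exp_nat_mul]
  exact pow_le_pow_left₀ (Real.exp_pos _).le (exp_neg_le_two_mul_cosh t) m

theorem re_cosh_add_mul_I (t φ : ℝ) :
    (Complex.cosh (t + φ * Complex.I)).re = Real.cosh t * Real.cos φ := by
  rw [Complex.cosh_add, Complex.cosh_mul_I, Complex.sinh_mul_I, ← Complex.ofReal_cosh,
    ← Complex.ofReal_cos, ← Complex.ofReal_sinh, ← Complex.ofReal_sin]
  simp [-Complex.ofReal_cos, -Complex.ofReal_sin, -Complex.ofReal_cosh, -Complex.ofReal_sinh]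

theorem norm_sinh_add_mul_I_le (t φ : ℝ) :
    ‖Complex.sinh (t + φ * Complex.I)‖ ≤ Real.cosh t := by
  rw [Complex.sinh, norm_div, Real.cosh_eq]
  refine div_le_div₀ (by positivity) ((norm_sub_le _ _).trans ?_) two_pos (by simp)
  simp [Complex.norm_exp]

/-- The integrand `exp (-x cosh z - m z)` of the Bessel function `K_m` along a line `Im z = φ`. -/
noncomputable def besselKernel (x : ℝ) (m : ℕ) (z : ℂ) : ℂ :=
  Complex.exp (-x * Complex.cosh z - m * z)

theorem continuous_besselKernel (x : ℝ) (m : ℕ) : Continuous (besselKernel x m) := by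
  unfold besselKernel
  fun_prop

theorem norm_besselKernel (x : ℝ) (m : ℕ) (t φ : ℝ) :
    ‖besselKernel x m (t + φ * Complex.I)‖
      = Real.exp (-(x * Real.cos φ) * Real.cosh t) * Real.exp (-(m * t)) := by
  rw [besselKernel, Complex.norm_exp, ← Real.exp_add]
  congr 1
  rw [Complex.sub_re, ← Complex.ofReal_neg, Complex.re_ofReal_mul, re_cosh_add_mul_I]
  simp
  ring

theorem norm_besselKernel_le {x c : ℝ} (m : ℕ) {φ : ℝ} (hc : c ≤ x * Real.cos φ) (t : ℝ) :
    ‖besselKernel x m (t + φ * Complex.I)‖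
      ≤ 2 ^ m * (Real.exp (-c * Real.cosh t) * Real.cosh t ^ m) := by
  have hpos : 0 < Real.cosh t := Real.cosh_pos t
  rw [norm_besselKernel]
  calc _ ≤ Real.exp (-c * Real.cosh t) * (2 ^ m * Real.cosh t ^ m) := by
        gcongr
        exact exp_neg_nat_mul_le m t
    _ = _ := by ring

theorem hasDerivAt_besselKernel (x : ℝ) (m : ℕ) (z : ℂ) :
    HasDerivAt (besselKernel x m) (besselKernel x m z * (-x * Complex.sinh z - m)) z := by
  have h := (((Complex.hasDerivAt_cosh z).const_mul (-x : ℂ)).sub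
    ((hasDerivAt_id z).const_mul (m : ℂ))).cexp
  simpa only [mul_one, besselKernel] using! h

theorem norm_deriv_besselKernel_le {x c : ℝ} (hx : 0 < x) (m : ℕ) {φ : ℝ}
    (hc : c ≤ x * Real.cos φ) (t : ℝ) :
    ‖besselKernel x m (t + φ * Complex.I) * (-x * Complex.sinh (t + φ * Complex.I) - m)‖
      ≤ 2 ^ m * (x + m) * (Real.exp (-c * Real.cosh t) * Real.cosh t ^ (m + 1)) := by
  have hpos : 0 < Real.cosh t := Real.cosh_pos t
  have h1 : ‖-x * Complex.sinh (t + φ * Complex.I) - m‖ ≤ (x + m) * Real.cosh t := by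
    refine (norm_sub_le _ _).trans ?_
    rw [norm_mul, norm_neg, Complex.norm_real, Real.norm_of_nonneg hx.le, Complex.norm_natCast,
      add_mul]
    gcongr
    · exact norm_sinh_add_mul_I_le t φ
    · exact le_mul_of_one_le_right (Nat.cast_nonneg m) (Real.one_le_cosh t)
  rw [norm_mul]
  refine (mul_le_mul (norm_besselKernel_le m hc t) h1 (norm_nonneg _) (by positivity)).trans_eq ?_
  ring

theorem integrable_besselKernel {x : ℝ} (m : ℕ) {φ : ℝ} (h : 0 < x * Real.cos φ) :
    Integrable fun t : ℝ => besselKernel x m (t + φ * Complex.I) :=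
  ((integrable_exp_neg_cosh_mul_pow h m).const_mul (2 ^ m)).mono'
    ((continuous_besselKernel x m).comp (by fun_prop)).aestronglyMeasurable
    (.of_forall fun t => norm_besselKernel_le m le_rfl t)

theorem integrable_deriv_besselKernel {x : ℝ} (hx : 0 < x) (m : ℕ) {φ : ℝ}
    (h : 0 < x * Real.cos φ) :
    Integrable fun t : ℝ => besselKernel x m (t + φ * Complex.I) *
      (-x * Complex.sinh (t + φ * Complex.I) - m) :=
  ((integrable_exp_neg_cosh_mul_pow h (m + 1)).const_mul (2 ^ m * (x + m))).mono'
    (((continuous_besselKernel x m).comp (by fun_prop)).mul (by fun_prop)).aestronglyMeasurable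
    (.of_forall fun t => norm_deriv_besselKernel_le hx m le_rfl t)

theorem integral_deriv_besselKernel {x : ℝ} (hx : 0 < x) (m : ℕ) {φ : ℝ}
    (h : 0 < x * Real.cos φ) :
    ∫ t : ℝ, besselKernel x m (t + φ * Complex.I) *
      (-x * Complex.sinh (t + φ * Complex.I) - m) = 0 := by
  have hlim : Tendsto (fun t : ℝ => besselKernel x m (t + φ * Complex.I)) (cocompact ℝ) (𝓝 0) :=
    squeeze_zero_norm (norm_besselKernel_le m le_rfl)
      (by simpa using (tendsto_exp_neg_cosh_mul_pow h m).const_mul (2 ^ m))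
  have hder : ∀ t : ℝ, HasDerivAt (fun t : ℝ => besselKernel x m (t + φ * Complex.I))
      (besselKernel x m (t + φ * Complex.I) *
        (-x * Complex.sinh (t + φ * Complex.I) - m)) t := fun t => by
    simpa using! (hasDerivAt_besselKernel x m _).comp t
      ((Complex.ofRealCLM.hasDerivAt (x := t)).add_const (φ * Complex.I))
  rw [integral_of_hasDerivAt_of_tendsto hder (integrable_deriv_besselKernel hx m h)
    (hlim.mono_left atBot_le_cocompact) (hlim.mono_left atTop_le_cocompact), sub_zero]

theorem hasDerivAt_integral_besselKernel {x : ℝ} (hx : 0 < x) (m : ℕ) {φ : ℝ}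
    (h : 0 < Real.cos φ) :
    HasDerivAt (fun ψ : ℝ => ∫ t : ℝ, besselKernel x m (t + ψ * Complex.I)) 0 φ := by
  have hs : {ψ : ℝ | Real.cos φ / 2 < Real.cos ψ} ∈ 𝓝 φ :=
    (isOpen_lt continuous_const Real.continuous_cos).mem_nhds (by simpa using half_lt_self h)
  have hc : 0 < x * (Real.cos φ / 2) := by positivity
  have key := hasDerivAt_integral_of_dominated_loc_of_deriv_le (𝕜 := ℝ) (μ := volume)
    (F := fun (ψ : ℝ) (t : ℝ) => besselKernel x m (t + ψ * Complex.I))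
    (F' := fun (ψ : ℝ) (t : ℝ) => besselKernel x m (t + ψ * Complex.I) *
      (-x * Complex.sinh (t + ψ * Complex.I) - m) * Complex.I)
    (bound := fun t => 2 ^ m * (x + m) *
      (Real.exp (-(x * (Real.cos φ / 2)) * Real.cosh t) * Real.cosh t ^ (m + 1)))
    hs
    (.of_forall fun ψ => ((continuous_besselKernel x m).comp (by fun_prop)).aestronglyMeasurable)
    (integrable_besselKernel m (by positivity))
    ((((continuous_besselKernel x m).comp (by fun_prop)).mul
      (by fun_prop)).mul continuous_const).aestronglyMeasurable
    (.of_forall fun t ψ hψ => by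
      rw [norm_mul, Complex.norm_I, mul_one]
      exact norm_deriv_besselKernel_le hx m (mul_le_mul_of_nonneg_left (le_of_lt hψ) hx.le) t)
    ((integrable_exp_neg_cosh_mul_pow hc (m + 1)).const_mul _)
    (.of_forall fun t ψ _ => by
      simpa using! (hasDerivAt_besselKernel x m _).comp ψ
        (((Complex.ofRealCLM.hasDerivAt (x := ψ)).mul_const Complex.I).const_add (t : ℂ)))
  have h0 : ∫ t : ℝ, besselKernel x m (t + φ * Complex.I) *
      (-x * Complex.sinh (t + φ * Complex.I) - m) * Complex.I = 0 := by
    rw [integral_mul_const, integral_deriv_besselKernel hx m (by positivity), zero_mul]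
  rw [← h0]
  exact key.2

/-- Contour shift: the integral of `besselKernel` does not depend on the horizontal line
within the strip `|Im z| < π / 2`. -/
theorem integral_besselKernel_eq {x : ℝ} (hx : 0 < x) (m : ℕ) {φ : ℝ} (h : |φ| < Real.pi / 2) :
    ∫ t : ℝ, besselKernel x m (t + φ * Complex.I) = ∫ t : ℝ, besselKernel x m t := by
  have hd : ∀ ψ ∈ Set.Ioo (-(Real.pi / 2)) (Real.pi / 2), HasDerivAt
      (fun ψ : ℝ => ∫ t : ℝ, besselKernel x m (t + ψ * Complex.I)) 0 ψ := fun ψ hψ =>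
    hasDerivAt_integral_besselKernel hx m (Real.cos_pos_of_mem_Ioo hψ)
  simpa using isOpen_Ioo.is_const_of_deriv_eq_zero isPreconnected_Ioo
    (fun ψ hψ => (hd ψ hψ).differentiableAt.differentiableWithinAt)
    (fun ψ hψ => (hd ψ hψ).deriv) (abs_lt.1 h)
    (show (0 : ℝ) ∈ Set.Ioo (-(Real.pi / 2)) (Real.pi / 2) by
      constructor <;> linarith [Real.pi_pos])

theorem besselKernel_ofReal (x : ℝ) (m : ℕ) (t : ℝ) :
    besselKernel x m t = (Real.exp (-x * Real.cosh t - m * t) : ℝ) := by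
  simp [besselKernel]

theorem integrable_besselKernel_ofReal {x : ℝ} (hx : 0 < x) (m : ℕ) :
    Integrable fun t : ℝ => besselKernel x m t := by
  simpa using integrable_besselKernel (x := x) m (φ := 0) (by simpa using hx)

theorem integral_besselKernel {x : ℝ} (hx : 0 < x) (m : ℕ) :
    ∫ t : ℝ, besselKernel x m t = 2 * besselK m x := by
  simp_rw [besselKernel_ofReal]
  rw [integral_complex_ofReal]
  norm_cast
  have hker : Integrable fun t : ℝ => Real.exp (-x * Real.cosh t - m * t) := by
    have := (integrable_besselKernel (x := x) m (φ := 0) (by simpa using hx)).re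
    simpa only [Complex.ofReal_zero, zero_mul, add_zero, besselKernel_ofReal, RCLike.re_to_complex,
      Complex.ofReal_re] using this
  rw [← setIntegral_univ, ← Set.Iic_union_Ioi (a := (0 : ℝ)),
    setIntegral_union (Set.Iic_disjoint_Ioi le_rfl) measurableSet_Ioi hker.integrableOn
      hker.integrableOn]
  have h1 := integral_comp_neg_Ioi 0 fun t : ℝ => Real.exp (-x * Real.cosh t - m * t)
  rw [neg_zero] at h1
  have hker' := hker.comp_neg
  rw [← h1, ← integral_add hker'.integrableOn hker.integrableOn, besselK, ← integral_const_mul]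
  refine integral_congr_ae (.of_forall fun t => ?_)
  simp only [Real.cosh_neg]
  rw [Real.cosh_eq (m * t), sub_eq_add_neg, sub_eq_add_neg, Real.exp_add, Real.exp_add]
  ring_nf

theorem besselK_add_two_sub {x : ℝ} (hx : 0 < x) (n : ℕ) :
    x / 2 * (besselK (n + 2) x - besselK n x) = (n + 1) * besselK (n + 1) x := by
  have h := integral_deriv_besselKernel hx (n + 1) (φ := 0) (by simpa using hx)
  have hi := integrable_besselKernel_ofReal hx
  have hpt : ∀ t : ℝ, besselKernel x (n + 1) (t + (0 : ℝ) * Complex.I) *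
      (-x * Complex.sinh (t + (0 : ℝ) * Complex.I) - (n + 1 : ℕ))
      = x / 2 * (besselKernel x (n + 2) t - besselKernel x n t)
        - (n + 1) * besselKernel x (n + 1) t := fun t => by
    have h2 : besselKernel x (n + 2) t = besselKernel x (n + 1) t * Complex.exp (-t) := by
      rw [besselKernel, besselKernel, ← Complex.exp_add]
      push_cast; ring_nf
    have h3 : besselKernel x n t = besselKernel x (n + 1) t * Complex.exp t := by
      rw [besselKernel, besselKernel, ← Complex.exp_add]
      push_cast; ring_nf
    rw [h2, h3, Complex.ofReal_zero, zero_mul, add_zero, Complex.sinh]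
    push_cast
    ring
  have hsub : Integrable fun t : ℝ => (x / 2 : ℂ) *
      (besselKernel x (n + 2) t - besselKernel x n t) := ((hi _).sub (hi _)).const_mul _
  simp_rw [hpt] at h
  rw [integral_sub hsub ((hi _).const_mul _), integral_const_mul,
    integral_const_mul, integral_sub (hi _) (hi _), integral_besselKernel hx,
    integral_besselKernel hx, integral_besselKernel hx] at h
  norm_cast at h
  push_cast at h
  linarith

theorem summable_besselI (n : ℕ) (x : ℝ) :
    Summable fun m : ℕ =>
      (x / 2) ^ (n + 2 * m) / ((Nat.factorial m : ℝ) * (Nat.factorial (n + m) : ℝ)) := by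
  refine Summable.of_norm_bounded
    ((Real.summable_pow_div_factorial (|x / 2| ^ 2)).mul_left (|x / 2| ^ n)) fun m => ?_
  rw [norm_div, norm_pow, Real.norm_eq_abs, Real.norm_of_nonneg (by positivity), pow_add, pow_mul,
    mul_div_assoc]
  gcongr
  exact le_mul_of_one_le_right (by positivity) (mod_cast Nat.one_le_iff_ne_zero.2 (by positivity))

theorem besselI_sub_add_two (n : ℕ) (x : ℝ) :
    x / 2 * (besselI n x - besselI (n + 2) x) = (n + 1) * besselI (n + 1) x := by
  have hn := summable_besselI n x
  have hn' := (summable_nat_add_iff 1).2 hn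
  have h1 := summable_besselI (n + 1) x
  simp only [besselI]
  rw [hn.tsum_eq_zero_add, h1.tsum_eq_zero_add, add_sub_assoc,
    ← hn'.tsum_sub (summable_besselI (n + 2) x), mul_add, mul_add, ← tsum_mul_left,
    ← tsum_mul_left]
  congr 1
  · rw [show n + 1 + 0 = n + 0 + 1 by ring, Nat.factorial_succ]
    push_cast
    field_simp
    ring_nf
  · refine tsum_congr fun m => ?_
    rw [show n + 2 + m = n + m + 1 + 1 by ring, show n + 1 + (m + 1) = n + m + 1 + 1 by ring,
      show n + (m + 1) = n + m + 1 by ring, Nat.factorial_succ (n + m + 1), Nat.factorial_succ m]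
    push_cast
    field_simp
    ring

theorem integral_exp_int_mul_I (p : ℤ) :
    ∫ θ in (0 : ℝ)..(2 * Real.pi), Complex.exp (p * Complex.I * θ)
      = if p = 0 then 2 * Real.pi else 0 := by
  split_ifs with hp
  · simp [hp]
  · rw [integral_exp_mul_complex (by simp [hp])]
    have h : Complex.exp (p * Complex.I * ((2 * Real.pi : ℝ) : ℂ)) = 1 := by
      rw [← Complex.exp_int_mul_two_pi_mul_I p]
      push_cast
      ring_nf
    rw [h]
    simp

theorem hasSum_exp_mul_cosh (y : ℝ) (z : ℂ) :
    HasSum (fun q : ℕ × ℕ => (y / 2 : ℂ) ^ q.1 / q.1.factorial * ((y / 2 : ℂ) ^ q.2 / q.2.factorial)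
      * Complex.exp ((q.1 - q.2) * z)) (Complex.exp (y * Complex.cosh z)) := by
  have h1 := NormedSpace.expSeries_div_hasSum_exp (y / 2 * Complex.exp z)
  have h2 := NormedSpace.expSeries_div_hasSum_exp (y / 2 * Complex.exp (-z))
  have hs := summable_mul_of_summable_norm h1.summable.norm h2.summable.norm
  have h := h1.mul h2 hs
  rw [← Complex.exp_eq_exp_ℂ, ← Complex.exp_add] at h
  have hcosh : y * Complex.cosh z = y / 2 * Complex.exp z + y / 2 * Complex.exp (-z) := by
    rw [Complex.cosh]
    ring
  rw [hcosh]
  refine h.congr_fun fun q => ?_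
  · rw [mul_pow, mul_pow, ← Complex.exp_nat_mul, ← Complex.exp_nat_mul, sub_mul, sub_eq_add_neg,
      Complex.exp_add]
    ring_nf

/-- The Fourier coefficients of `θ ↦ exp (y cosh (t + iθ))`. -/
theorem integral_exp_mul_exp_cosh (p : ℕ) (y t : ℝ) :
    ∫ θ in (0 : ℝ)..(2 * Real.pi),
        Complex.exp (p * Complex.I * θ) * Complex.exp (y * Complex.cosh (t + θ * Complex.I))
      = 2 * Real.pi * besselI p y * Complex.exp (-(p * t)) := by
  set a : ℕ × ℕ → ℂ := fun q =>
    (y / 2 : ℂ) ^ q.1 / q.1.factorial * ((y / 2 : ℂ) ^ q.2 / q.2.factorial)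
      * Complex.exp ((q.1 - q.2) * t) with ha
  have hterm : ∀ (q : ℕ × ℕ) (θ : ℝ), Complex.exp (p * Complex.I * θ) *
      ((y / 2 : ℂ) ^ q.1 / q.1.factorial * ((y / 2 : ℂ) ^ q.2 / q.2.factorial)
        * Complex.exp ((q.1 - q.2) * (t + θ * Complex.I)))
      = a q * Complex.exp (((p + q.1 - q.2 : ℤ) : ℂ) * Complex.I * θ) := fun q θ => by
    have he : Complex.exp (p * Complex.I * θ) * Complex.exp ((q.1 - q.2) * (t + θ * Complex.I))
        = Complex.exp ((q.1 - q.2) * t) *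
          Complex.exp (((p + q.1 - q.2 : ℤ) : ℂ) * Complex.I * θ) := by
      rw [← Complex.exp_add, ← Complex.exp_add]
      push_cast
      ring_nf
    rw [ha, mul_left_comm, he, ← mul_assoc]
  have hsum : HasSum (fun q => ∫ θ in (0 : ℝ)..(2 * Real.pi),
      a q * Complex.exp (((p + q.1 - q.2 : ℤ) : ℂ) * Complex.I * θ))
      (∫ θ in (0 : ℝ)..(2 * Real.pi),
        Complex.exp (p * Complex.I * θ) * Complex.exp (y * Complex.cosh (t + θ * Complex.I))) := by
    refine intervalIntegral.hasSum_integral_of_dominated_convergence (fun q _ => ‖a q‖)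
      (fun q => (by fun_prop : Continuous _).aestronglyMeasurable) (fun q => .of_forall fun θ _ => ?_)
      (.of_forall fun θ _ => (hasSum_exp_mul_cosh y t).summable.norm) intervalIntegrable_const
      (.of_forall fun θ _ => ?_)
    · rw [norm_mul, Complex.norm_exp]
      simp
    · simpa only [hterm] using
        (hasSum_exp_mul_cosh y (t + θ * Complex.I)).mul_left (Complex.exp (p * Complex.I * θ))
  simp_rw [intervalIntegral.integral_const_mul, integral_exp_int_mul_I] at hsum
  have hinj : Function.Injective fun m : ℕ => ((m, p + m) : ℕ × ℕ) := fun m m' h =>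
    congrArg Prod.fst h
  rw [← hinj.hasSum_iff] at hsum
  · rw [← hsum.tsum_eq, besselI, Complex.ofReal_tsum, ← tsum_mul_left, ← tsum_mul_right]
    refine tsum_congr fun m => ?_
    simp only [Function.comp, ha]
    rw [if_pos (by push_cast; ring)]
    push_cast
    rw [show ((m : ℂ) - (p + m)) * t = -(p * t) by ring]
    field_simp
    ring
  · rintro ⟨j, k⟩ hq
    rw [if_neg, Complex.ofReal_zero, mul_zero]
    rintro h
    exact hq ⟨j, by ext <;> simp; omega⟩

/-- Integral representation of `K_1(lρ) (1 - b exp(iθ)) / ρ`, where `ρ = |1 - b exp(iθ)|`. -/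
theorem besselK_one_mul_eq_integral {l b : ℝ} (hl : 0 < l) (hb : b ∈ Set.Ioo (0 : ℝ) 1) (θ : ℝ) :
    2 * (besselK 1 (l * Real.sqrt (1 - 2 * b * Real.cos θ + b ^ 2)) : ℂ) *
        ((1 - b * Complex.exp (θ * Complex.I)) / Real.sqrt (1 - 2 * b * Real.cos θ + b ^ 2))
      = ∫ t : ℝ, Complex.exp ((l * b : ℝ) * Complex.cosh (t + θ * Complex.I)) *
          besselKernel l 1 t := by
  obtain ⟨hb0, hb1⟩ := hb
  set w : ℂ := 1 - b * Complex.exp (θ * Complex.I) with hw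
  have hwre : w.re = 1 - b * Real.cos θ := by
    simp [hw, Complex.exp_ofReal_mul_I_re]
  have hwim : w.im = -(b * Real.sin θ) := by
    simp [hw, Complex.exp_ofReal_mul_I_im]
  have hpos : 0 < w.re := by
    rw [hwre]
    nlinarith [Real.cos_le_one θ]
  have hnorm : ‖w‖ = Real.sqrt (1 - 2 * b * Real.cos θ + b ^ 2) := by
    rw [Complex.norm_def, Complex.normSq_apply, hwre, hwim]
    congr 1
    linear_combination b ^ 2 * Real.sin_sq_add_cos_sq θ
  rw [← hnorm]
  have hw0 : w ≠ 0 := fun h => by simp [h] at hpos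
  have hn0 : (‖w‖ : ℂ) ≠ 0 := by simpa using hw0
  have harg := Complex.norm_mul_exp_arg_mul_I w
  have harg' : (‖w‖ : ℂ) * Complex.exp (-(w.arg * Complex.I))
      = 1 - b * Complex.exp (-(θ * Complex.I)) := by
    have := congrArg (starRingEnd ℂ) harg
    rw [map_mul, Complex.conj_ofReal, ← Complex.exp_conj, map_mul, Complex.conj_ofReal,
      Complex.conj_I, mul_neg] at this
    rw [this, hw, map_sub, map_mul, map_one, Complex.conj_ofReal, ← Complex.exp_conj, map_mul,
      Complex.conj_ofReal, Complex.conj_I, mul_neg]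
  have hlpos : 0 < l * ‖w‖ := by positivity
  have hker := integral_besselKernel_eq hlpos 1
    (Complex.abs_arg_lt_pi_div_two_iff.2 (.inl hpos))
  rw [integral_besselKernel hlpos 1] at hker
  have hdiv : w / ‖w‖ = Complex.exp (w.arg * Complex.I) := by
    rw [div_eq_iff hn0, mul_comm, harg]
  rw [← hker, hdiv, ← integral_mul_const]
  refine integral_congr_ae (.of_forall fun t => ?_)
  have hcosh : (‖w‖ : ℂ) * Complex.cosh (t + w.arg * Complex.I)
      = Complex.cosh t - b * Complex.cosh (t + θ * Complex.I) := by
    rw [Complex.cosh, Complex.cosh, Complex.cosh, neg_add, neg_add, Complex.exp_add,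
      Complex.exp_add, Complex.exp_add, Complex.exp_add]
    linear_combination (Complex.exp t / 2) * harg + (Complex.exp (-t) / 2) * harg'
      + (Complex.exp t / 2) * hw
  simp only [besselKernel]
  rw [← Complex.exp_add, ← Complex.exp_add]
  congr 1
  push_cast
  linear_combination (-l : ℂ) * hcosh

theorem integrable_exp_cosh_mul_besselKernel {l b : ℝ} (hl : 0 < l) (hb : b ∈ Set.Ioo (0 : ℝ) 1)
    {g : ℝ → ℂ} (hg : Continuous g) (hg1 : ∀ θ, ‖g θ‖ ≤ 1) :
    Integrable (Function.uncurry fun θ t : ℝ => g θ *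
        (Complex.exp ((l * b : ℝ) * Complex.cosh (t + θ * Complex.I)) * besselKernel l 1 t))
      ((volume.restrict (Set.uIoc 0 (2 * Real.pi))).prod volume) := by
  obtain ⟨hb0, hb1⟩ := hb
  have : IsFiniteMeasure (volume.restrict (Set.uIoc 0 (2 * Real.pi))) :=
    isFiniteMeasure_restrict.2 measure_Ioc_lt_top.ne
  have hc : 0 < l * (1 - b) := mul_pos hl (by linarith)
  have hbound := (integrable_const (μ := volume.restrict (Set.uIoc 0 (2 * Real.pi)))
    (2 : ℝ)).mul_prod (integrable_exp_neg_cosh_mul_pow hc 1)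
  refine hbound.mono' ?_ (.of_forall fun ⟨θ, t⟩ => ?_)
  · have := continuous_besselKernel l 1
    exact Continuous.aestronglyMeasurable (by unfold Function.uncurry; fun_prop)
  · have hcosh := Real.cosh_pos t
    have h1 := norm_besselKernel l 1 t 0
    have h2 := exp_neg_nat_mul_le 1 t
    simp only [Real.cos_zero, mul_one, Complex.ofReal_zero, zero_mul, add_zero, pow_one] at h1 h2
    simp only [Function.uncurry]
    rw [norm_mul, norm_mul, h1, Complex.norm_exp, Complex.re_ofReal_mul, re_cosh_add_mul_I]
    have h3 : Real.exp (l * b * (Real.cosh t * Real.cos θ)) ≤ Real.exp (l * b * Real.cosh t) := by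
      gcongr
      exact mul_le_of_le_one_right hcosh.le (Real.cos_le_one θ)
    calc _ ≤ 1 * (Real.exp (l * b * Real.cosh t) *
          (Real.exp (-l * Real.cosh t) * (2 * Real.cosh t))) := by
          gcongr
          exact hg1 θ
      _ = _ := by
          rw [show -(l * (1 - b)) * Real.cosh t = l * b * Real.cosh t + -l * Real.cosh t by ring,
            Real.exp_add]
          ring

theorem norm_sin_mul_exp_le_one (p : ℕ) (θ : ℝ) :
    ‖(Real.sin θ : ℂ) * Complex.exp (p * θ * Complex.I)‖ ≤ 1 := by
  rw [norm_mul, Complex.norm_real, Complex.norm_exp]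
  simpa using Real.abs_sin_le_one θ

theorem integral_sin_mul_exp_mul_integral {l b : ℝ} (hl : 0 < l) (hb : b ∈ Set.Ioo (0 : ℝ) 1)
    (k : ℕ) :
    ∫ θ in (0 : ℝ)..(2 * Real.pi), Real.sin θ * Complex.exp ((k + 1 : ℕ) * θ * Complex.I) *
        ∫ t : ℝ, Complex.exp ((l * b : ℝ) * Complex.cosh (t + θ * Complex.I)) * besselKernel l 1 t
      = ((2 * Real.pi * (besselI k (l * b) * besselK (k + 1) l
          - besselI (k + 2) (l * b) * besselK (k + 3) l) : ℝ) : ℂ) * Complex.I := by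
  have hinner : ∀ t : ℝ, ∫ θ in (0 : ℝ)..(2 * Real.pi),
      Real.sin θ * Complex.exp ((k + 1 : ℕ) * θ * Complex.I) *
        (Complex.exp ((l * b : ℝ) * Complex.cosh (t + θ * Complex.I)) * besselKernel l 1 t)
      = Real.pi * Complex.I * besselI k (l * b) * besselKernel l (k + 1) t
        - Real.pi * Complex.I * besselI (k + 2) (l * b) * besselKernel l (k + 3) t := fun t => by
    have hpt : ∀ θ : ℝ, Real.sin θ * Complex.exp ((k + 1 : ℕ) * θ * Complex.I) *
        (Complex.exp ((l * b : ℝ) * Complex.cosh (t + θ * Complex.I)) * besselKernel l 1 t)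
        = (Complex.exp (k * Complex.I * θ) *
              Complex.exp ((l * b : ℝ) * Complex.cosh (t + θ * Complex.I))
            - Complex.exp ((k + 2 : ℕ) * Complex.I * θ) *
              Complex.exp ((l * b : ℝ) * Complex.cosh (t + θ * Complex.I)))
          * (Complex.I / 2 * besselKernel l 1 t) := fun θ => by
      have h1 : Complex.exp (k * Complex.I * θ)
          = Complex.exp ((k + 1 : ℕ) * θ * Complex.I) * Complex.exp (-θ * Complex.I) := by
        rw [← Complex.exp_add]
        push_cast
        ring_nf
      have h2 : Complex.exp ((k + 2 : ℕ) * Complex.I * θ)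
          = Complex.exp ((k + 1 : ℕ) * θ * Complex.I) * Complex.exp (θ * Complex.I) := by
        rw [← Complex.exp_add]
        push_cast
        ring_nf
      rw [h1, h2, Complex.ofReal_sin, Complex.sin]
      ring
    have h1 : besselKernel l (k + 1) t = Complex.exp (-(k * t)) * besselKernel l 1 t := by
      rw [besselKernel, besselKernel, ← Complex.exp_add]
      push_cast
      ring_nf
    have h2 : besselKernel l (k + 3) t
        = Complex.exp (-((k + 2 : ℕ) * t)) * besselKernel l 1 t := by
      rw [besselKernel, besselKernel, ← Complex.exp_add]
      push_cast
      ring_nf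
    simp_rw [hpt]
    rw [intervalIntegral.integral_mul_const, intervalIntegral.integral_sub
      (Continuous.intervalIntegrable (by fun_prop) _ _)
      (Continuous.intervalIntegrable (by fun_prop) _ _), integral_exp_mul_exp_cosh,
      integral_exp_mul_exp_cosh, h1, h2]
    ring
  have hi := integrable_besselKernel_ofReal hl
  simp_rw [← integral_const_mul]
  rw [intervalIntegral_integral_swap
    (integrable_exp_cosh_mul_besselKernel hl hb (by fun_prop) (norm_sin_mul_exp_le_one (k + 1)))]
  simp_rw [hinner]
  rw [integral_sub ((hi _).const_mul _) ((hi _).const_mul _), integral_const_mul,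
    integral_const_mul, integral_besselKernel hl, integral_besselKernel hl]
  push_cast
  ring

/-- the integration-by-parts identity
`−(λb/2π)∫_0^{2π} K_1(λρ(θ)) (sin θ/ρ(θ)) (sin(nθ) − b sin((n+1)θ)) dθ
  = b(n+1) I_{n+1}(λb) K_{n+1}(λ) − n I_n(λb) K_n(λ)` where `ρ(θ) = √(1−2b cos θ+b²)`. -/
theorem bessel_fourier_coeff_deriv (l b : ℝ) (hl : 0 < l) (hb : b ∈ Set.Ioo (0:ℝ) 1)
    (n : ℕ) (hn : 1 ≤ n) :
    -(l * b / (2 * Real.pi)) * ∫ θ in (0:ℝ)..(2 * Real.pi),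
        besselK 1 (l * Real.sqrt (1 - 2 * b * Real.cos θ + b ^ 2)) *
          (Real.sin θ / Real.sqrt (1 - 2 * b * Real.cos θ + b ^ 2)) *
          (Real.sin (n * θ) - b * Real.sin ((n + 1) * θ))
      = b * (n + 1) * besselI (n + 1) (l * b) * besselK (n + 1) l
        - n * (besselI n (l * b) * besselK n l) := by
  obtain ⟨k, rfl⟩ : ∃ k, n = k + 1 := ⟨n - 1, by omega⟩
  set P : ℝ → ℂ := fun θ => Real.sin θ * Complex.exp ((k + 1 : ℕ) * θ * Complex.I) *
    ∫ t : ℝ, Complex.exp ((l * b : ℝ) * Complex.cosh (t + θ * Complex.I)) * besselKernel l 1 t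
    with hP
  have hPint : IntervalIntegrable P volume 0 (2 * Real.pi) := by
    rw [intervalIntegrable_iff]
    have h := (integrable_exp_cosh_mul_besselKernel hl hb (by fun_prop)
        (norm_sin_mul_exp_le_one (k + 1))).integral_prod_left
    simp only [Function.uncurry, integral_const_mul] at h
    exact h
  have hpt : ∀ θ : ℝ, besselK 1 (l * Real.sqrt (1 - 2 * b * Real.cos θ + b ^ 2)) *
          (Real.sin θ / Real.sqrt (1 - 2 * b * Real.cos θ + b ^ 2)) *
          (Real.sin ((k + 1 : ℕ) * θ) - b * Real.sin (((k + 1 : ℕ) + 1) * θ))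
      = 1 / 2 * (P θ).im := fun θ => by
    have him : (Complex.exp ((k + 1 : ℕ) * θ * Complex.I) *
        (1 - b * Complex.exp (θ * Complex.I))).im
        = Real.sin ((k + 1 : ℕ) * θ) - b * Real.sin (((k + 1 : ℕ) + 1) * θ) := by
      have : Complex.exp ((k + 1 : ℕ) * θ * Complex.I) * (1 - b * Complex.exp (θ * Complex.I))
          = Complex.exp ((((k + 1 : ℕ) * θ : ℝ) : ℂ) * Complex.I)
            - b * Complex.exp (((((k + 1 : ℕ) + 1) * θ : ℝ) : ℂ) * Complex.I) := by
        rw [mul_sub, mul_one, mul_left_comm, ← Complex.exp_add]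
        push_cast
        ring_nf
      rw [this, Complex.sub_im, Complex.im_ofReal_mul, Complex.exp_ofReal_mul_I_im,
        Complex.exp_ofReal_mul_I_im]
    have hPθ : P θ = ((2 * (besselK 1 (l * Real.sqrt (1 - 2 * b * Real.cos θ + b ^ 2)) *
          (Real.sin θ / Real.sqrt (1 - 2 * b * Real.cos θ + b ^ 2))) : ℝ) : ℂ) *
        (Complex.exp ((k + 1 : ℕ) * θ * Complex.I) * (1 - b * Complex.exp (θ * Complex.I))) := by
      simp only [hP]
      rw [← besselK_one_mul_eq_integral hl hb θ]
      push_cast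
      ring
    rw [hPθ, Complex.im_ofReal_mul, him]
    ring
  have hval : ∫ θ in (0 : ℝ)..(2 * Real.pi), (P θ).im = 2 * Real.pi *
      (besselI k (l * b) * besselK (k + 1) l - besselI (k + 2) (l * b) * besselK (k + 3) l) := by
    have h := Complex.imCLM.intervalIntegral_comp_comm hPint
    simp only [Complex.imCLM_apply] at h
    rw [h, integral_sin_mul_exp_mul_integral hl hb k, Complex.im_ofReal_mul, Complex.I_im, mul_one]
  simp_rw [hpt]
  rw [intervalIntegral.integral_const_mul, hval]
  have hK := besselK_add_two_sub hl (k + 1)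
  have hI := besselI_sub_add_two k (l * b)
  have hpi := Real.pi_ne_zero
  push_cast at hK ⊢
  field_simp
  linear_combination (2 * b * besselI (k + 2) (l * b)) * hK - (2 * besselK (k + 1) l) * hI
end

section
/- Let λ>0 and b∈(0,1). Then n²·( Ω_{n+1}^+(λ,b) − Ω_n^+(λ,b) ) → 1/2 and n²·( Ω_{n+1}^−(λ,b) − Ω_n^−(λ,b) ) → −1/2 as n→∞. -/
open Real MeasureTheory Filter

theorem besselI_summable (n : ℕ) {x : ℝ} (hx : 0 < x) :
    Summable fun m : ℕ =>
      (x / 2) ^ (n + 2 * m) / ((Nat.factorial m : ℝ) * (Nat.factorial (n + m) : ℝ)) := by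
  refine Summable.of_nonneg_of_le (fun m => by positivity) (fun m => ?_)
    ((Real.summable_pow_div_factorial ((x / 2) ^ 2)).mul_left ((x / 2) ^ n))
  have h1 : (1 : ℝ) ≤ (Nat.factorial (n + m) : ℝ) := by
    exact_mod_cast Nat.one_le_iff_ne_zero.2 (Nat.factorial_ne_zero _)
  rw [pow_add, pow_mul, ← mul_div_assoc]
  gcongr
  exact le_mul_of_one_le_right (by positivity) h1

theorem besselI_pos (n : ℕ) {x : ℝ} (hx : 0 < x) : 0 < besselI n x :=
  (besselI_summable n hx).tsum_pos (fun m => by positivity) 0 (by positivity)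

/-- Recurrence relation `I_n - I_{n+2} = (2(n+1)/x) I_{n+1}`. -/
theorem besselI_recurrence (n : ℕ) {x : ℝ} (hx : 0 < x) :
    besselI n x = 2 * (n + 1) / x * besselI (n + 1) x + besselI (n + 2) x := by
  have h0 := besselI_summable n hx
  have h1 := (besselI_summable (n + 1) hx).mul_left (2 * (n + 1) / x)
  have key : besselI n x - 2 * (n + 1) / x * besselI (n + 1) x = besselI (n + 2) x := by
    unfold besselI
    rw [← tsum_mul_left, ← h0.tsum_sub h1, (h0.sub h1).tsum_eq_zero_add]
    have hzero : (x / 2) ^ (n + 2 * 0) / ((Nat.factorial 0 : ℝ) * (Nat.factorial (n + 0) : ℝ)) -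
        2 * (n + 1) / x * ((x / 2) ^ (n + 1 + 2 * 0) /
          ((Nat.factorial 0 : ℝ) * (Nat.factorial (n + 1 + 0) : ℝ))) = 0 := by
      simp only [mul_zero, add_zero, Nat.factorial_succ, pow_succ]
      push_cast
      field_simp
      ring
    rw [hzero, zero_add]
    refine tsum_congr fun m => ?_
    rw [show n + (m + 1) = n + m + 1 by ring, show n + 1 + (m + 1) = n + m + 1 + 1 by ring,
      show n + 2 + m = n + m + 1 + 1 by ring, show n + 2 * (m + 1) = n + 2 * m + 2 by ring,
      show n + 1 + 2 * (m + 1) = n + 2 * m + 3 by ring,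
      show n + 2 + 2 * m = n + 2 * m + 2 by ring]
    simp only [Nat.factorial_succ, pow_succ]
    push_cast
    field_simp
    ring
  linarith

theorem besselI_mul_le (n : ℕ) {x b : ℝ} (hx : 0 < x) (hb : 0 < b) (hb1 : b ≤ 1) :
    besselI n (x * b) ≤ b ^ n * besselI n x := by
  unfold besselI
  rw [← tsum_mul_left]
  refine (besselI_summable n (mul_pos hx hb)).tsum_le_tsum (fun m => ?_)
    ((besselI_summable n hx).mul_left _)
  rw [show x * b / 2 = b * (x / 2) by ring, mul_pow, pow_add b, mul_assoc, mul_div_assoc]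
  gcongr
  exact mul_le_of_le_one_left (by positivity) (pow_le_one₀ hb.le hb1)

theorem besselI_one_mul_lt {x b : ℝ} (hx : 0 < x) (hb : 0 < b) (hb1 : b < 1) :
    besselI 1 (x * b) < b * besselI 1 x := by
  unfold besselI
  rw [← tsum_mul_left]
  have hle : ∀ m : ℕ, (x * b / 2) ^ (1 + 2 * m) = b * (b ^ (2 * m) * (x / 2) ^ (1 + 2 * m)) := by
    intro m
    rw [show x * b / 2 = b * (x / 2) by ring, mul_pow, pow_add b]
    ring
  refine Summable.tsum_lt_tsum (i := 1) (fun m => ?_) ?_ (besselI_summable 1 (mul_pos hx hb))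
    ((besselI_summable 1 hx).mul_left _)
  · rw [hle, mul_div_assoc]
    gcongr
    exact mul_le_of_le_one_left (by positivity) (pow_le_one₀ hb.le hb1.le)
  · rw [hle, mul_div_assoc]
    gcongr
    exact mul_lt_of_lt_one_left (by positivity) (pow_lt_one₀ hb.le hb1 (by norm_num))

/-- Leading order of `I_n(x)` as `n → ∞`. -/
theorem besselI_tendsto {x : ℝ} (hx : 0 < x) :
    Tendsto (fun n : ℕ => besselI n x * (Nat.factorial n : ℝ) / (x / 2) ^ n) atTop (nhds 1) := by
  have hlim : Tendsto (fun n : ℕ => 1 + Real.exp ((x / 2) ^ 2) * (1 / ((n : ℝ) + 1)))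
      atTop (nhds 1) := by
    simpa using (tendsto_one_div_add_atTop_nhds_zero_nat.const_mul
      (Real.exp ((x / 2) ^ 2))).const_add (1 : ℝ)
  refine tendsto_of_tendsto_of_tendsto_of_le_of_le tendsto_const_nhds hlim (fun n => ?_)
    (fun n => ?_)
  · dsimp only
    rw [le_div_iff₀ (by positivity), one_mul, ← div_le_iff₀ (by positivity)]
    have := (besselI_summable n hx).le_tsum 0 (fun m _ => by positivity)
    simpa [besselI] using this
  · have hexp : HasSum (fun m : ℕ => ((x / 2) ^ 2) ^ m / (Nat.factorial m : ℝ))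
        (Real.exp ((x / 2) ^ 2)) := by
      rw [Real.exp_eq_exp_ℝ]
      exact NormedSpace.expSeries_div_hasSum_exp _
    have hsum := ((hasSum_ite_eq (0 : ℕ) (1 : ℝ)).add (hexp.mul_right (1 / ((n : ℝ) + 1)))).mul_left
      ((x / 2) ^ n / (Nat.factorial n : ℝ))
    dsimp only
    rw [div_le_iff₀ (by positivity), ← le_div_iff₀ (by positivity), mul_div_assoc, mul_comm,
      ← hsum.tsum_eq]
    refine (besselI_summable n hx).tsum_le_tsum (fun m => ?_) hsum.summable
    rcases Nat.eq_zero_or_pos m with rfl | hm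
    · simp only [mul_zero, add_zero, if_true, pow_zero, Nat.factorial_zero, Nat.cast_one, one_mul]
      exact le_mul_of_one_le_right (by positivity) (le_add_of_nonneg_right (by positivity))
    · have hfac : (Nat.factorial n : ℝ) * (n + 1) ≤ (Nat.factorial (n + m) : ℝ) := by
        have := Nat.factorial_le (show n + 1 ≤ n + m by lia)
        rw [Nat.factorial_succ, mul_comm] at this
        exact_mod_cast this
      rw [if_neg hm.ne', zero_add, div_mul_div_comm, div_mul_div_comm, mul_one, pow_add, pow_mul]
      refine div_le_div_of_nonneg_left (by positivity) (by positivity) ?_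
      calc (Nat.factorial n : ℝ) * (Nat.factorial m * (n + 1))
          = Nat.factorial m * (Nat.factorial n * (n + 1)) := by ring
        _ ≤ _ := by gcongr

theorem cosh_le_exp_of_nonneg {y : ℝ} (hy : 0 ≤ y) : Real.cosh y ≤ Real.exp y := by
  rw [Real.cosh_eq]
  have : Real.exp (-y) ≤ Real.exp y := Real.exp_le_exp.2 (by linarith)
  linarith

theorem exp_neg_mul_cosh_mul_cosh_le (n : ℕ) {x t : ℝ} (hx : 0 < x) (ht : 0 ≤ t) :
    Real.exp (-x * Real.cosh t) * Real.cosh ((n : ℝ) * t) ≤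
      Real.exp (((n : ℝ) + 1) ^ 2 / x) * Real.exp (-1 * t) := by
  have h1 : Real.cosh ((n : ℝ) * t) ≤ Real.exp ((n : ℝ) * t) :=
    cosh_le_exp_of_nonneg (by positivity)
  have h2 : t ^ 2 / 4 ≤ Real.cosh t := by
    rw [Real.cosh_eq]
    have := Real.quadratic_le_exp_of_nonneg ht
    have := Real.exp_pos (-t)
    linarith
  calc Real.exp (-x * Real.cosh t) * Real.cosh ((n : ℝ) * t)
      ≤ Real.exp (-x * Real.cosh t) * Real.exp ((n : ℝ) * t) := by gcongr
    _ = Real.exp (-x * Real.cosh t + n * t) := (Real.exp_add _ _).symm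
    _ ≤ Real.exp (((n : ℝ) + 1) ^ 2 / x + -1 * t) := by
        apply Real.exp_le_exp.2
        have h3 : x * (t ^ 2 / 4) ≤ x * Real.cosh t := by gcongr
        have h4 : ((n : ℝ) + 1) ^ 2 / x + x * (t ^ 2 / 4) - (n + 1) * t =
            (n + 1 - x * t / 2) ^ 2 / x := by
          field_simp
          ring
        have h5 : 0 ≤ ((n : ℝ) + 1 - x * t / 2) ^ 2 / x := by positivity
        linarith
    _ = _ := Real.exp_add _ _

theorem besselK_integrableOn (n : ℕ) {x : ℝ} (hx : 0 < x) :
    IntegrableOn (fun t : ℝ => Real.exp (-x * Real.cosh t) * Real.cosh ((n : ℝ) * t))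
      (Set.Ioi 0) := by
  refine integrable_of_isBigO_exp_neg (b := 1) one_pos
    (Continuous.continuousOn (by fun_prop)) ?_
  refine Asymptotics.IsBigO.of_bound (Real.exp (((n : ℝ) + 1) ^ 2 / x)) ?_
  filter_upwards [eventually_ge_atTop 0] with t ht
  rw [Real.norm_of_nonneg (Real.exp_pos _).le,
    Real.norm_of_nonneg (mul_nonneg (Real.exp_pos _).le (Real.cosh_pos _).le)]
  exact exp_neg_mul_cosh_mul_cosh_le n hx ht

theorem besselK_pos (n : ℕ) {x : ℝ} (hx : 0 < x) : 0 < besselK n x := by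
  unfold besselK
  rw [setIntegral_pos_iff_support_of_nonneg_ae
    (Eventually.of_forall fun t => mul_nonneg (Real.exp_pos _).le (Real.cosh_pos _).le)
    (besselK_integrableOn n hx)]
  have : (Function.support fun t : ℝ =>
      Real.exp (-x * Real.cosh t) * Real.cosh ((n : ℝ) * t)) = Set.univ :=
    Set.eq_univ_of_forall fun t => (mul_pos (Real.exp_pos _) (Real.cosh_pos _)).ne'
  rw [this, Set.univ_inter, Real.volume_Ioi]
  exact ENNReal.zero_lt_top

theorem besselK_antitone (n : ℕ) {x y : ℝ} (hx : 0 < x) (hxy : x ≤ y) :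
    besselK n y ≤ besselK n x := by
  refine integral_mono (besselK_integrableOn n (hx.trans_le hxy)) (besselK_integrableOn n hx)
    fun t => ?_
  have := (Real.cosh_pos t).le
  have := (Real.cosh_pos (n * t)).le
  dsimp only
  gcongr

/-- Recurrence relation `K_{n+2} - K_n = (2(n+1)/x) K_{n+1}`. -/
theorem besselK_recurrence (n : ℕ) {x : ℝ} (hx : 0 < x) :
    besselK (n + 2) x = 2 * (n + 1) / x * besselK (n + 1) x + besselK n x := by
  have i0 := (besselK_integrableOn n hx).const_mul (x / 2)
  have i1 := (besselK_integrableOn (n + 1) hx).const_mul ((n : ℝ) + 1)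
  have i2 := (besselK_integrableOn (n + 2) hx).const_mul (x / 2)
  have hder : ∀ t ∈ Set.Ici (0 : ℝ),
      HasDerivAt (fun t : ℝ => Real.exp (-x * Real.cosh t) * Real.sinh ((n + 1) * t))
        ((n + 1) * (Real.exp (-x * Real.cosh t) * Real.cosh (((n + 1 : ℕ) : ℝ) * t)) -
          x / 2 * (Real.exp (-x * Real.cosh t) * Real.cosh (((n + 2 : ℕ) : ℝ) * t)) +
          x / 2 * (Real.exp (-x * Real.cosh t) * Real.cosh ((n : ℝ) * t))) t := by
    intro t _
    have h := (((Real.hasDerivAt_cosh t).const_mul (-x)).exp).mul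
      (((hasDerivAt_id t).const_mul ((n : ℝ) + 1)).sinh)
    refine h.congr_deriv ?_
    have e2 : Real.cosh (((n + 2 : ℕ) : ℝ) * t) = Real.cosh ((n + 1) * t) * Real.cosh t +
        Real.sinh ((n + 1) * t) * Real.sinh t := by
      rw [← Real.cosh_add]; push_cast; ring_nf
    have e0 : Real.cosh ((n : ℝ) * t) = Real.cosh ((n + 1) * t) * Real.cosh t -
        Real.sinh ((n + 1) * t) * Real.sinh t := by
      rw [← Real.cosh_sub]; ring_nf
    rw [e2, e0]
    push_cast
    simp only [id]
    ring
  have hlim : Tendsto (fun t : ℝ => Real.exp (-x * Real.cosh t) * Real.sinh ((n + 1) * t))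
      atTop (nhds 0) := by
    have h0 : Tendsto (fun t : ℝ => Real.exp (((n + 1 : ℕ) + 1 : ℝ) ^ 2 / x) * Real.exp (-1 * t))
        atTop (nhds 0) := by
      simpa using Real.tendsto_exp_neg_atTop_nhds_zero.const_mul
        (Real.exp (((n + 1 : ℕ) + 1 : ℝ) ^ 2 / x))
    refine squeeze_zero' ?_ ?_ h0
    · filter_upwards [eventually_ge_atTop 0] with t ht
      exact mul_nonneg (Real.exp_pos _).le (Real.sinh_nonneg_iff.2 (by positivity))
    · filter_upwards [eventually_ge_atTop 0] with t ht
      refine le_trans ?_ (exp_neg_mul_cosh_mul_cosh_le (n + 1) hx ht)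
      push_cast
      gcongr
      exact (Real.sinh_lt_cosh _).le
  have h := integral_Ioi_of_hasDerivAt_of_tendsto' hder ((i1.sub i2).add i0) hlim
  rw [integral_add (by exact i1.sub i2) i0, integral_sub i1 i2, integral_const_mul,
    integral_const_mul, integral_const_mul] at h
  simp only [mul_zero, Real.sinh_zero, sub_zero] at h
  change (n + 1) * besselK (n + 1) x - x / 2 * besselK (n + 2) x + x / 2 * besselK n x = 0 at h
  field_simp
  linarith

theorem integral_pow_mul_exp_neg_mul_Ioi (n : ℕ) {c : ℝ} (hc : 0 < c) :
    ∫ u in Set.Ioi (0 : ℝ), u ^ n * Real.exp (-(c * u)) = (Nat.factorial n : ℝ) / c ^ (n + 1) := by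
  have h := Real.integral_rpow_mul_exp_neg_mul_Ioi (a := (n : ℝ) + 1) (by positivity) hc
  rw [Real.Gamma_nat_eq_factorial, ← Nat.cast_add_one, Real.rpow_natCast] at h
  simp only [Nat.cast_add_one, add_sub_cancel_right, Real.rpow_natCast] at h
  rw [h, one_div, inv_pow, inv_mul_eq_div]

theorem integrableOn_pow_mul_exp_neg_mul_Ioi (n : ℕ) {c : ℝ} (hc : 0 < c) :
    IntegrableOn (fun u : ℝ => u ^ n * Real.exp (-(c * u))) (Set.Ioi 0) := by
  apply Integrable.of_integral_ne_zero
  rw [integral_pow_mul_exp_neg_mul_Ioi n hc]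
  positivity

theorem integrableOn_pow_mul_exp_neg_mul_add_inv_Ioi (n : ℕ) {c : ℝ} (hc : 0 < c) :
    IntegrableOn (fun u : ℝ => u ^ n * Real.exp (-(c * (u + u⁻¹)))) (Set.Ioi 0) := by
  refine (integrableOn_pow_mul_exp_neg_mul_Ioi n hc).mono' (by fun_prop) ?_
  refine (ae_restrict_iff' measurableSet_Ioi).2 (Eventually.of_forall fun u hu => ?_)
  have hu : 0 < u := hu
  rw [Real.norm_of_nonneg (by positivity)]
  gcongr
  exact le_add_of_nonneg_right (by positivity)

/-- The integral representation `2 K_{n+1}(x) = ∫_0^∞ u^n exp(-(x/2)(u + 1/u)) du`. -/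
theorem two_mul_besselK_succ (n : ℕ) {x : ℝ} (hx : 0 < x) :
    2 * besselK (n + 1) x =
      ∫ u in Set.Ioi (0 : ℝ), u ^ n * Real.exp (-(x / 2 * (u + u⁻¹))) := by
  have himg : Real.exp '' Set.univ = Set.Ioi 0 := by rw [Set.image_univ, Real.range_exp]
  have hd : ∀ t ∈ Set.univ, HasDerivWithinAt Real.exp (Real.exp t) Set.univ t :=
    fun t _ => (Real.hasDerivAt_exp t).hasDerivWithinAt
  have hexp_int := integrableOn_pow_mul_exp_neg_mul_add_inv_Ioi n (half_pos hx)
  rw [← himg, integrableOn_image_iff_integrableOn_abs_deriv_smul MeasurableSet.univ hd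
    Real.exp_injective.injOn] at hexp_int
  rw [← himg, integral_image_eq_integral_abs_deriv_smul MeasurableSet.univ hd
    Real.exp_injective.injOn]
  have hfun : (fun t : ℝ => |Real.exp t| • (Real.exp t ^ n *
      Real.exp (-(x / 2 * (Real.exp t + (Real.exp t)⁻¹))))) =
      fun t => Real.exp (-x * Real.cosh t) * Real.exp (((n + 1 : ℕ) : ℝ) * t) := by
    funext t
    rw [abs_of_pos (Real.exp_pos t), smul_eq_mul, ← mul_assoc, ← pow_succ', ← Real.exp_nat_mul,
      ← Real.exp_neg, Real.cosh_eq, mul_comm]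
    ring_nf
  rw [hfun] at hexp_int ⊢
  simp only [Measure.restrict_univ, integrableOn_univ] at hexp_int ⊢
  have hneg := hexp_int.comp_neg
  have heq := integral_neg_eq_self
    (fun t => Real.exp (-x * Real.cosh t) * Real.exp (((n + 1 : ℕ) : ℝ) * t)) volume
  unfold besselK
  rw [← integral_comp_abs
    (f := fun t => Real.exp (-x * Real.cosh t) * Real.cosh (((n + 1 : ℕ) : ℝ) * t))]
  have hc : (fun t : ℝ => Real.exp (-x * Real.cosh |t|) * Real.cosh (((n + 1 : ℕ) : ℝ) * |t|)) =
      fun t => 2⁻¹ * (Real.exp (-x * Real.cosh t) * Real.exp (((n + 1 : ℕ) : ℝ) * t) +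
        Real.exp (-x * Real.cosh (-t)) * Real.exp (((n + 1 : ℕ) : ℝ) * -t)) := by
    funext t
    rw [Real.cosh_abs, ← abs_of_nonneg (Nat.cast_nonneg (α := ℝ) (n + 1)), ← abs_mul,
      Real.cosh_abs, Real.cosh_neg, Real.cosh_eq (_ * t), abs_of_nonneg (by positivity)]
    ring_nf
  rw [hc, integral_const_mul, integral_add hexp_int hneg, heq]
  ring

/-- Leading order of `K_{n+1}(x)` as `n → ∞`. -/
theorem besselK_tendsto {x : ℝ} (hx : 0 < x) :
    Tendsto (fun n : ℕ => 2 * besselK (n + 1) x * (x / 2) ^ (n + 1) / (Nat.factorial n : ℝ))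
      atTop (nhds 1) := by
  have hc := half_pos hx
  have hlim : Tendsto (fun n : ℕ => 1 - (x / 2) ^ 2 / (n : ℝ)) atTop (nhds 1) := by
    simpa using (tendsto_const_div_atTop_nhds_zero_nat ((x / 2) ^ 2)).const_sub (1 : ℝ)
  refine tendsto_of_tendsto_of_tendsto_of_le_of_le' hlim tendsto_const_nhds ?_
    (Eventually.of_forall fun n => ?_)
  · filter_upwards [eventually_ge_atTop 1] with n hn
    obtain ⟨k, rfl⟩ : ∃ k, n = k + 1 := ⟨n - 1, by lia⟩
    have i1 := integrableOn_pow_mul_exp_neg_mul_Ioi (k + 1) hc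
    have i0 := (integrableOn_pow_mul_exp_neg_mul_Ioi k hc).const_mul (x / 2)
    have hle : (Nat.factorial (k + 1) : ℝ) / (x / 2) ^ (k + 1 + 1) -
        x / 2 * ((Nat.factorial k : ℝ) / (x / 2) ^ (k + 1)) ≤ 2 * besselK (k + 1 + 1) x := by
      rw [two_mul_besselK_succ _ hx, ← integral_pow_mul_exp_neg_mul_Ioi _ hc,
        ← integral_pow_mul_exp_neg_mul_Ioi _ hc, ← integral_const_mul, ← integral_sub i1 i0]
      refine setIntegral_mono_on (i1.sub i0)
        (integrableOn_pow_mul_exp_neg_mul_add_inv_Ioi _ hc) measurableSet_Ioi fun u hu => ?_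
      have hu : 0 < u := hu
      have he := Real.add_one_le_exp (-(x / 2 * u⁻¹))
      rw [mul_add, neg_add, Real.exp_add]
      calc u ^ (k + 1) * Real.exp (-(x / 2 * u)) - x / 2 * (u ^ k * Real.exp (-(x / 2 * u)))
          = u ^ (k + 1) * (Real.exp (-(x / 2 * u)) * (-(x / 2 * u⁻¹) + 1)) := by
            field_simp
            ring
        _ ≤ _ := by gcongr
    rw [le_div_iff₀ (by positivity), ← div_le_iff₀ (by positivity)]
    refine le_trans (le_of_eq ?_) hle
    rw [Nat.factorial_succ]
    push_cast
    field_simp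
    ring
  · rw [div_le_iff₀ (by positivity), one_mul, ← le_div_iff₀ (by positivity),
      two_mul_besselK_succ _ hx, ← integral_pow_mul_exp_neg_mul_Ioi _ hc]
    refine setIntegral_mono_on (integrableOn_pow_mul_exp_neg_mul_add_inv_Ioi _ hc)
      (integrableOn_pow_mul_exp_neg_mul_Ioi _ hc) measurableSet_Ioi fun u hu => ?_
    have hu : 0 < u := hu
    gcongr
    exact le_add_of_nonneg_right (by positivity)

theorem besselI_mul_besselK_succ_tendsto {x : ℝ} (hx : 0 < x) :
    Tendsto (fun n : ℕ => besselI n x * besselK (n + 1) x) atTop (nhds (1 / x)) := by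
  have h := ((besselI_tendsto hx).mul (besselK_tendsto hx)).mul_const (1 / x)
  rw [one_mul, one_mul] at h
  refine h.congr fun n => ?_
  have : (Nat.factorial n : ℝ) ≠ 0 := by positivity
  field_simp
  ring

theorem tendsto_zero_of_inv_eq {r w : ℕ → ℝ} {x : ℝ} (hx : 0 < x) (hr : ∀ n, 0 < r n)
    (hw : ∀ n, 0 < w n) (h : ∀ n : ℕ, (r n)⁻¹ = 2 * (n + 1) / x + w n) :
    Tendsto r atTop (nhds 0) := by
  have hlim : Tendsto (fun n : ℕ => x / 2 * (1 / ((n : ℝ) + 1))) atTop (nhds 0) := by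
    simpa using tendsto_one_div_add_atTop_nhds_zero_nat.const_mul (x / 2)
  refine squeeze_zero (fun n => (hr n).le) (fun n => ?_) hlim
  calc r n = (2 * (n + 1) / x + w n)⁻¹ := by rw [← h, inv_inv]
    _ ≤ (2 * ((n : ℝ) + 1) / x)⁻¹ := by
        gcongr
        exact le_add_of_nonneg_right (hw n).le
    _ = _ := by field_simp

theorem tendsto_natCast_mul_of_inv_eq {r w : ℕ → ℝ} {x : ℝ} (hx : 0 < x)
    (hw : Tendsto w atTop (nhds 0)) (h : ∀ n : ℕ, (r n)⁻¹ = 2 * (n + 1) / x + w n) :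
    Tendsto (fun n : ℕ => (n : ℝ) * r n) atTop (nhds (x / 2)) := by
  have h1 : Tendsto (fun n : ℕ => 2 / x + (2 / x + w n) * (1 / (n : ℝ))) atTop (nhds (2 / x)) := by
    simpa using ((hw.const_add (2 / x)).mul tendsto_one_div_atTop_nhds_zero_nat).const_add (2 / x)
  have h2 := h1.inv₀ (by positivity)
  rw [inv_div] at h2
  refine h2.congr' ?_
  filter_upwards [eventually_ge_atTop 1] with n hn
  have hn : (0 : ℝ) < n := by exact_mod_cast hn
  rw [← inv_inj, inv_inv, mul_inv, h]
  field_simp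
  ring

theorem inv_besselI_ratio (n : ℕ) {x : ℝ} (hx : 0 < x) :
    (besselI (n + 1) x / besselI n x)⁻¹ =
      2 * (n + 1) / x + besselI (n + 1 + 1) x / besselI (n + 1) x := by
  have := besselI_pos (n + 1) hx
  rw [inv_div, besselI_recurrence n hx]
  field_simp

theorem inv_besselK_ratio (n : ℕ) {x : ℝ} (hx : 0 < x) :
    (besselK (n + 1) x / besselK (n + 1 + 1) x)⁻¹ =
      2 * (n + 1) / x + besselK n x / besselK (n + 1) x := by
  have := besselK_pos (n + 1) hx
  rw [inv_div, besselK_recurrence n hx]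
  field_simp

theorem besselI_ratio_tendsto {x : ℝ} (hx : 0 < x) :
    Tendsto (fun n : ℕ => besselI (n + 1) x / besselI n x) atTop (nhds 0) :=
  tendsto_zero_of_inv_eq hx (fun _ => div_pos (besselI_pos _ hx) (besselI_pos _ hx))
    (fun _ => div_pos (besselI_pos _ hx) (besselI_pos _ hx)) fun n => inv_besselI_ratio n hx

theorem besselK_ratio_tendsto {x : ℝ} (hx : 0 < x) :
    Tendsto (fun n : ℕ => besselK n x / besselK (n + 1) x) atTop (nhds 0) :=
  (tendsto_add_atTop_iff_nat 1).1 <| tendsto_zero_of_inv_eq hx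
    (fun _ => div_pos (besselK_pos _ hx) (besselK_pos _ hx))
    (fun _ => div_pos (besselK_pos _ hx) (besselK_pos _ hx)) fun n => inv_besselK_ratio n hx

theorem besselI_mul_besselK_tendsto {x : ℝ} (hx : 0 < x) :
    Tendsto (fun n : ℕ => besselI n x * besselK n x) atTop (nhds 0) := by
  have h := (besselI_mul_besselK_succ_tendsto hx).mul (besselK_ratio_tendsto hx)
  rw [mul_zero] at h
  refine h.congr fun n => ?_
  have := besselK_pos (n + 1) hx
  field_simp

/-- `n² (I_n K_n - I_{n+1} K_{n+1}) → 1/2`. -/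
theorem sq_mul_besselI_mul_besselK_sub_tendsto {x : ℝ} (hx : 0 < x) :
    Tendsto (fun n : ℕ => (n : ℝ) ^ 2 *
      (besselI n x * besselK n x - besselI (n + 1) x * besselK (n + 1) x))
      atTop (nhds (1 / 2)) := by
  have hI := (besselI_mul_besselK_succ_tendsto hx).comp (tendsto_add_atTop_nat 1)
  have hu0 := besselI_ratio_tendsto hx
  have hv0 := besselK_ratio_tendsto hx
  have hu := (tendsto_natCast_mul_of_inv_eq hx (hu0.comp (tendsto_add_atTop_nat 1))
    fun n => inv_besselI_ratio n hx).comp (tendsto_add_atTop_nat 1)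
  have hv := (tendsto_natCast_mul_of_inv_eq hx hv0 fun n => inv_besselK_ratio n hx).add
    (hv0.comp (tendsto_add_atTop_nat 1))
  have hw := ((hu0.comp (tendsto_add_atTop_nat 2)).const_add (2 / x)).sub hv0
  have h := ((hI.mul hu).mul hv).mul hw
  rw [show 1 / x * (x / 2) * (x / 2 + 0) * (2 / x + 0 - 0) = 1 / 2 by field_simp; ring] at h
  refine (tendsto_add_atTop_iff_nat 1).1 (h.congr fun n => ?_)
  simp only [Function.comp_apply]
  have hi1 := besselI_pos (n + 1) hx
  have hi2 := besselI_pos (n + 2) hx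
  have hk1 := besselK_pos (n + 1) hx
  have hk2 := besselK_pos (n + 2) hx
  have e1 := inv_besselI_ratio (n + 1) hx
  have e2 := inv_besselK_ratio n hx
  have e3 : 2 / x + besselI (n + 2 + 1) x / besselI (n + 2) x - besselK n x / besselK (n + 1) x =
      besselI (n + 1) x / besselI (n + 2) x - besselK (n + 2) x / besselK (n + 1) x := by
    rw [inv_div] at e1 e2
    rw [e1, e2]
    push_cast
    ring
  rw [e3]
  push_cast
  simp only [add_assoc, Nat.reduceAdd]
  field_simp

theorem abs_sqrt_sq_sub_sub_le {s d : ℝ} (hs : 0 < s) (hd : 0 ≤ d) :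
    |Real.sqrt (s ^ 2 - d) - s| ≤ d / s := by
  have hup : Real.sqrt (s ^ 2 - d) ≤ s := Real.sqrt_le_iff.2 ⟨hs.le, by linarith⟩
  have hds : 0 ≤ d / s := by positivity
  have hmul : s * (d / s) = d := by field_simp
  rw [abs_sub_comm, abs_of_nonneg (by linarith), sub_le_comm]
  rcases le_total (s - d / s) 0 with h | h
  · exact h.trans (Real.sqrt_nonneg _)
  · refine Real.le_sqrt_of_sq_le ?_
    nlinarith [mul_nonneg hds h]

theorem natCast_mul_Lam_tendsto {l b : ℝ} (hl : 0 < l) (hb : b ∈ Set.Ioo (0 : ℝ) 1) :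
    Tendsto (fun n : ℕ => (n : ℝ) * Lam n l b) atTop (nhds 0) := by
  have hlim := (tendsto_self_mul_const_pow_of_lt_one hb.1.le hb.2).mul
    (besselI_mul_besselK_tendsto hl)
  rw [mul_zero] at hlim
  refine squeeze_zero (fun n => ?_) (fun n => ?_) hlim
  · exact mul_nonneg n.cast_nonneg
      (mul_pos (besselI_pos n (mul_pos hl hb.1)) (besselK_pos n hl)).le
  · rw [Lam, mul_assoc, ← mul_assoc (b ^ n)]
    have := besselK_pos n hl
    gcongr
    exact besselI_mul_le n hl hb.1 hb.2.le

theorem Om_tendsto {x : ℝ} (hx : 0 < x) :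
    Tendsto (fun n : ℕ => Om n x) atTop (nhds (besselI 1 x * besselK 1 x)) := by
  simpa [Om] using (besselI_mul_besselK_tendsto hx).const_sub (besselI 1 x * besselK 1 x)

theorem one_add_sq_mul_Lam_one_lt {l b : ℝ} (hl : 0 < l) (hb : b ∈ Set.Ioo (0 : ℝ) 1) :
    (1 + b ^ 2) * Lam 1 l b <
      b * (besselI 1 l * besselK 1 l + besselI 1 (l * b) * besselK 1 (l * b)) := by
  obtain ⟨hb0, hb1⟩ := hb
  have hlb := mul_pos hl hb0
  have h1 := mul_lt_mul_of_pos_right (besselI_one_mul_lt hl hb0 hb1) (besselK_pos 1 hl)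
  have h2 : besselK 1 l ≤ besselK 1 (l * b) :=
    besselK_antitone 1 hlb (mul_le_of_le_one_right hl.le hb1.le)
  have h3 : b * besselK 1 l ≤ besselK 1 (l * b) :=
    (mul_le_of_le_one_left (besselK_pos 1 hl).le hb1.le).trans h2
  have h4 := mul_le_mul_of_nonneg_left h3 (mul_pos hb0 (besselI_pos 1 hlb)).le
  unfold Lam
  linarith

theorem sq_mul_sqrt_Del_sub_tendsto {l b : ℝ} (hl : 0 < l) (hb : b ∈ Set.Ioo (0 : ℝ) 1) :
    Tendsto (fun n : ℕ => (n : ℝ) ^ 2 * (Real.sqrt (Del n l b) -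
      (b * (Om n l + Om n (l * b)) - (1 + b ^ 2) * Lam 1 l b))) atTop (nhds 0) := by
  have hpos := sub_pos.2 (one_add_sq_mul_Lam_one_lt hl hb)
  have hS := (((Om_tendsto hl).add (Om_tendsto (mul_pos hl hb.1))).const_mul b).sub_const
    ((1 + b ^ 2) * Lam 1 l b)
  have hlim := (((natCast_mul_Lam_tendsto hl hb).pow 2).const_mul (4 * b ^ 2)).div hS hpos.ne'
  rw [zero_pow two_ne_zero, mul_zero, zero_div] at hlim
  refine squeeze_zero_norm' ?_ hlim
  filter_upwards [hS.eventually (lt_mem_nhds hpos)] with n hn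
  have h := abs_sqrt_sq_sub_sub_le hn (show 0 ≤ 4 * b ^ 2 * Lam n l b ^ 2 by positivity)
  rw [Real.norm_eq_abs, abs_mul, abs_of_nonneg (by positivity : (0 : ℝ) ≤ (n : ℝ) ^ 2)]
  refine (mul_le_mul_of_nonneg_left h (by positivity)).trans (le_of_eq ?_)
  simp only [Pi.div_apply]
  ring

theorem tendsto_sq_mul_sub_of_tendsto_sq_mul {e : ℕ → ℝ}
    (he : Tendsto (fun n : ℕ => (n : ℝ) ^ 2 * e n) atTop (nhds 0)) :
    Tendsto (fun n : ℕ => (n : ℝ) ^ 2 * (e (n + 1) - e n)) atTop (nhds 0) := by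
  have h1 : Tendsto (fun n : ℕ => (n : ℝ) ^ 2 * e (n + 1)) atTop (nhds 0) := by
    have h := (he.comp (tendsto_add_atTop_nat 1)).norm
    rw [norm_zero] at h
    refine squeeze_zero_norm (fun n => ?_) h
    simp only [Function.comp_apply, norm_mul, norm_pow, Real.norm_natCast]
    gcongr
    lia
  simpa [mul_sub] using h1.sub he

/-- `n²(Ω_{n+1}^+ − Ω_n^+) → 1/2` and `n²(Ω_{n+1}^− − Ω_n^−) → −1/2`. -/
theorem eigenvalue_difference_asymptotic (l b : ℝ) (hl : 0 < l) (hb : b ∈ Set.Ioo (0:ℝ) 1) :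
    Tendsto (fun n : ℕ => (n : ℝ) ^ 2 * (OmP (n + 1) l b - OmP n l b)) atTop (nhds (1 / 2)) ∧
    Tendsto (fun n : ℕ => (n : ℝ) ^ 2 * (OmM (n + 1) l b - OmM n l b)) atTop (nhds (-(1 / 2))) := by
  have hb0 : b ≠ 0 := hb.1.ne'
  have he := (tendsto_sq_mul_sub_of_tendsto_sq_mul (sq_mul_sqrt_Del_sub_tendsto hl hb)).mul_const
    (1 / (2 * b))
  have hp := (sq_mul_besselI_mul_besselK_sub_tendsto hl).add he
  have hq := (sq_mul_besselI_mul_besselK_sub_tendsto (mul_pos hl hb.1)).neg.sub he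
  rw [zero_mul, add_zero] at hp
  rw [zero_mul, sub_zero] at hq
  refine ⟨hp.congr fun n => ?_, hq.congr fun n => ?_⟩
  · simp only [OmP, Bfun, Om]
    field_simp
    ring
  · simp only [OmM, Bfun, Om]
    field_simp
    ring
end
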